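/- Let D be a discrete polymatroid and q a prime power with q > N(D). A perfect linear index coding solution of dimension n over F_q exists for the index coding problem I^D(Z,R) constructed from D if and only if the discrete polymatroid nD is representable over F_q. -/

import Mathlib

open scoped Classical

/-- Sum of the components of `u` indexed by the elements of `A`. -/
noncomputable def setSum {r : ℕ} (u : Fin r → ℕ) (A : Set (Fin r)) : ℕ :=
  ∑ i ∈ Finset.univ.filter (· ∈ A), u i

/-- A discrete polymatroid on the ground set `{1,…,r}` (modelled as `Fin r`). -/
structure DiscretePolymatroid (r : ℕ) where
  carrier : Set (Fin r → ℕ)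
  nonempty : carrier.Nonempty
  finite : carrier.Finite
  lower : ∀ u ∈ carrier, ∀ v : Fin r → ℕ, (∀ i, v i ≤ u i) → v ∈ carrier
  exchange : ∀ u ∈ carrier, ∀ v ∈ carrier, (∑ i, u i) < (∑ i, v i) →
    ∃ w ∈ carrier, (∀ i, u i ≤ w i) ∧ u ≠ w ∧ ∀ i, w i ≤ max (u i) (v i)

namespace DiscretePolymatroid

variable {r : ℕ} (D : DiscretePolymatroid r)

/-- The rank function of a discrete polymatroid. -/
noncomputable def rho (A : Set (Fin r)) : ℕ :=
  D.finite.toFinset.sup fun u => setSum u A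

/-- `ρ_max(D) = max_i ρ({i})`. -/
noncomputable def rhoMax : ℕ := Finset.univ.sup fun i : Fin r => D.rho {i}

/-- The rank of the discrete polymatroid (the common component sum of its basis vectors). -/
noncomputable def rank : ℕ := D.rho Set.univ

end DiscretePolymatroid

/-- The subspaces `V i` of `F^d` represent the rank function `ρ'` when
`dim (∑_{i ∈ X} V i) = ρ'(X)` for every `X`. -/
def RepFnOver (r : ℕ) (ρ' : Set (Fin r) → ℕ) (F : Type) [Field F] : Prop :=
  ∃ (d : ℕ) (V : Fin r → Submodule F (Fin d → F)),
    ∀ X : Set (Fin r), Module.finrank F ↥(⨆ i ∈ X, V i) = ρ' X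

/-- A discrete polymatroid is representable over `F` if its rank function is. -/
def DiscretePolymatroid.RepresentableOver {r : ℕ} (D : DiscretePolymatroid r)
    (F : Type) [Field F] : Prop :=
  RepFnOver r D.rho F


/-- An index coding problem with message index type `M`: a receiver `(x, H)` demands the
message `x` and has the set of messages `H` as side information. -/
structure IndexProblem (M : Type) where
  recv : Set (M × Set M)

/-- A linear index coding solution over `F` of length `c` and dimension `n`: each message is
a row vector of length `n` over `F`, the encoding map `f` is linear, and every receiver can
recover its demanded message from its side information and `f(y)` by a linear decoding map. -/
def HasLinearIndexCode {M : Type} (P : IndexProblem M) (F : Type) [Field F]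
    (n c : ℕ) : Prop :=
  ∃ f : ((M → Fin n → F) →ₗ[F] (Fin c → F)),
    ∀ p ∈ P.recv, ∃ ψ : ((↥p.2 → Fin n → F) × (Fin c → F)) →ₗ[F] (Fin n → F),
      ∀ y : M → Fin n → F, ψ (fun j => y j.1, f y) = y p.1

namespace DiscretePolymatroid

variable {r : ℕ} (D : DiscretePolymatroid r)

/-- A basis vector of a discrete polymatroid: a maximal element of the carrier. -/
def IsBasisVec (b : Fin r → ℕ) : Prop :=
  b ∈ D.carrier ∧ ∀ u ∈ D.carrier, (∀ i, b i ≤ u i) → u = b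

/-- An excluded vector of a discrete polymatroid. -/
def IsExcluded (u : Fin r → ℕ) : Prop :=
  (∀ i, u i ≤ D.rho {i}) ∧ u ∉ D.carrier

/-- A minimal excluded vector of a discrete polymatroid. -/
def IsMinExcluded (u : Fin r → ℕ) : Prop :=
  D.IsExcluded u ∧ ∀ v, D.IsExcluded v → (∀ i, v i ≤ u i) → v = u

/-- The message index type of the index coding problem `I^D(Z,R)`:
`Sum.inl j` is the message `x_j` (`j ∈ {1,…,rank D}`), and `Sum.inr ⟨i,p⟩` is the message
`y_i^p` (`i ∈ {1,…,r}`, `p ∈ {1,…,ρ({i})}`). -/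
@[reducible] noncomputable def Msg : Type :=
  Fin D.rank ⊕ (Σ i : Fin r, Fin (D.rho {i}))

/-- The number of elements of a subset `T` of `Y` lying in `ζ_l = {y_l^1,…,y_l^{ρ({l})}}`. -/
noncomputable def sliceCard (T : Set (Σ i : Fin r, Fin (D.rho {i}))) (l : Fin r) : ℕ :=
  {p : Fin (D.rho {l}) | (⟨l, p⟩ : Σ i : Fin r, Fin (D.rho {i})) ∈ T}.ncard

/-- The index coding problem `I^D(Z,R)` constructed from the discrete polymatroid `D`,
with receiver set `R = R1 ∪ R2 ∪ R3`. -/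
noncomputable def indexProblem : IndexProblem D.Msg where
  recv :=
    -- R1
    {pr | ∃ b : Fin r → ℕ, D.IsBasisVec b ∧ ∃ j : Fin D.rank,
        ∃ T : Set (Σ i : Fin r, Fin (D.rho {i})),
          (∀ l : Fin r, D.sliceCard T l = b l) ∧
          pr = (Sum.inl j, Sum.inr '' T)} ∪
    -- R2
    {pr | ∃ c : Fin r → ℕ, D.IsMinExcluded c ∧ ∃ j : Fin r, c j ≠ 0 ∧
        ∃ p : Fin (D.rho {j}), ∃ T : Set (Σ i : Fin r, Fin (D.rho {i})),
          (∀ l : Fin r, l ≠ j → D.sliceCard T l = c l) ∧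
          D.sliceCard T j = c j - 1 ∧
          (⟨j, p⟩ : Σ i : Fin r, Fin (D.rho {i})) ∉ T ∧
          pr = (Sum.inr ⟨j, p⟩, Sum.inr '' T)} ∪
    -- R3
    {pr | ∃ (i : Fin r) (p : Fin (D.rho {i})),
        pr = (Sum.inr ⟨i, p⟩, Set.range Sum.inl)}

/-- `M(I^D(Z,R)) = ∑_{i=1}^r ρ({i})`: a perfect solution of dimension `n` has length
`n * indexCodeLen`. -/
noncomputable def indexCodeLen : ℕ := ∑ i : Fin r, D.rho {i}

/-- The bound `N(D)` on the field size. -/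
noncomputable def Nbound : ℕ :=
  1 + Finset.univ.sup fun i : Fin r =>
    ∑ b ∈ D.finite.toFinset.filter (fun b => D.IsBasisVec b ∧ 0 < b i),
      Nat.choose (D.rho {i}) (b i - 1) *
        ∏ j ∈ (Finset.univ.filter fun j : Fin r => b j ≠ 0).erase i,
          Nat.choose (D.rho {j}) (b j)

end DiscretePolymatroid

section LinearAlgebra

variable {K V : Type*} [Field K] [AddCommGroup V] [Module K V]

/-- A linear map whose kernel contains `ker g` factors through `g`. -/
theorem LinearMap.exists_comp_eq_of_ker_le_ker {U W : Type*} [AddCommGroup U] [Module K U]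
    [AddCommGroup W] [Module K W] (g : V →ₗ[K] W) (h : V →ₗ[K] U)
    (hk : LinearMap.ker g ≤ LinearMap.ker h) : ∃ ψ : W →ₗ[K] U, ψ ∘ₗ g = h := by
  obtain ⟨ψ, hψ⟩ := LinearMap.exists_extend
    (((LinearMap.ker g).liftQ h hk) ∘ₗ g.quotKerEquivRange.symm.toLinearMap)
  refine ⟨ψ, LinearMap.ext fun x => ?_⟩
  have h1 := LinearMap.congr_fun hψ (g.quotKerEquivRange (Submodule.Quotient.mk x))
  simpa using h1

/-- Over a field with more than `s.card` elements, `s` many proper subspaces of `U` do not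
cover `U`. -/
theorem Submodule.exists_mem_forall_notMem_of_card_lt [Finite K] [FiniteDimensional K V]
    {ι : Type*} (s : Finset ι) (U : Submodule K V) (P : ι → Submodule K V)
    (hP : ∀ i ∈ s, ¬ U ≤ P i) (hs : s.card < Nat.card K) :
    ∃ x ∈ U, ∀ i ∈ s, x ∉ P i := by
  have : Finite V := Module.finite_of_finite K
  have : Fintype V := Fintype.ofFinite V
  by_contra! hcov
  have hq : 1 < Nat.card K := Finite.one_lt_card
  have hsub : (U : Set V).toFinset ⊆ s.biUnion fun i => ((P i ⊓ U : Submodule K V) : Set V).toFinset := by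
    intro x hx
    obtain ⟨i, hi, hxi⟩ := hcov x (by simpa using hx)
    simp only [Finset.mem_biUnion, Set.mem_toFinset, SetLike.mem_coe, Submodule.mem_inf]
    exact ⟨i, hi, hxi, by simpa using hx⟩
  have hcardU : ∀ W : Submodule K V, (W : Set V).toFinset.card = Nat.card K ^ Module.finrank K W := by
    intro W
    rw [← Module.natCard_eq_pow_finrank (K := K), ← Set.ncard_eq_toFinset_card']
    rfl
  have hle := (Finset.card_le_card hsub).trans Finset.card_biUnion_le
  rw [hcardU] at hle
  have hlt : ∀ i ∈ s, Module.finrank K (P i ⊓ U : Submodule K V) + 1 ≤ Module.finrank K U := fun i hi =>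
    Submodule.finrank_lt_finrank_of_lt
      (lt_of_le_of_ne inf_le_right fun h => hP i hi (inf_eq_right.1 h))
  rcases s.eq_empty_or_nonempty with rfl | ⟨i₀, hi₀⟩
  · simp at hle
    omega
  obtain ⟨m, hm⟩ : ∃ m, Module.finrank K U = m + 1 :=
    ⟨Module.finrank K U - 1, by have := hlt i₀ hi₀; omega⟩
  rw [hm] at hle hlt
  have : ∑ i ∈ s, ((P i ⊓ U : Submodule K V) : Set V).toFinset.card ≤ s.card * Nat.card K ^ m := by
    rw [← smul_eq_mul]
    refine Finset.sum_le_card_nsmul _ _ _ fun i hi => ?_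
    rw [hcardU]
    exact Nat.pow_le_pow_right hq.le (by have := hlt i hi; omega)
  have h2 : s.card * Nat.card K ^ m < Nat.card K ^ (m + 1) := by
    rw [pow_succ, mul_comm]
    exact Nat.mul_lt_mul_of_pos_left hs (by positivity)
  omega

/-- Rado's theorem for a family of subspaces. -/
theorem exists_linearIndependent_mem_of_card_le_finrank [FiniteDimensional K V]
    {ι : Type*} [Finite ι] (U : ι → Submodule K V)
    (hU : ∀ S : Finset ι, S.card ≤ Module.finrank K ↥(⨆ i ∈ S, U i)) :
    ∃ v : ι → V, (∀ i, v i ∈ U i) ∧ LinearIndependent K v := by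
  have : Fintype ι := Fintype.ofFinite ι
  obtain ⟨W, hWU, hW⟩ := exists_minimal_le_of_wellFoundedLT
    (fun W : ι → Submodule K V => ∀ S : Finset ι, S.card ≤ Module.finrank K ↥(⨆ i ∈ S, W i)) U hU
  have key : ∀ i, ∃ x, W i = Submodule.span K {x} := by
    intro i
    have h1 := hW.prop {i}
    have hne : W i ≠ ⊥ := by
      intro h
      simp [h] at h1
    obtain ⟨x, hx, hx0⟩ := (Submodule.ne_bot_iff _).1 hne
    refine ⟨x, ?_⟩
    have hxW : Submodule.span K {x} ≤ W i := by simpa using hx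
    by_contra hnot
    obtain ⟨C, hC⟩ := exists_isCompl (Submodule.span K {x})
    have hsup : Submodule.span K {x} ⊔ (C ⊓ W i) = W i := by
      rw [← sup_inf_assoc_of_le _ hxW, hC.sup_eq_top, top_inf_eq]
    have hlt1 : Submodule.span K {x} < W i := lt_of_le_of_ne hxW (Ne.symm hnot)
    have hlt2 : C ⊓ W i < W i := by
      refine lt_of_le_of_ne inf_le_right fun h => hx0 ?_
      have hxC : x ∈ C := (inf_eq_right.1 h) hx
      have := hC.disjoint.le_bot ⟨Submodule.mem_span_singleton_self x, hxC⟩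
      simpa using this
    have viol : ∀ H : Submodule K V, H < W i → ∃ S : Finset ι, i ∉ S ∧
        Module.finrank K ↥(H ⊔ ⨆ j ∈ S, W j) ≤ S.card := by
      intro H hH
      have := hW.not_prop_of_lt (update_lt_self_iff.2 hH)
      push Not at this
      obtain ⟨S, hS⟩ := this
      have hiS : i ∈ S := by
        by_contra hiS
        have heq : (⨆ j ∈ S, Function.update W i H j) = ⨆ j ∈ S, W j :=
          biSup_congr fun j hj => Function.update_of_ne (by rintro rfl; exact hiS hj) _ _
        rw [heq] at hS
        exact absurd (hW.prop S) (by omega)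
      refine ⟨S.erase i, Finset.notMem_erase _ _, ?_⟩
      have heq : (⨆ j ∈ S, Function.update W i H j) = H ⊔ ⨆ j ∈ S.erase i, W j := by
        conv_lhs => rw [← Finset.insert_erase hiS]
        rw [Finset.iSup_insert, Function.update_self]
        congr 1
        exact biSup_congr fun j hj => Function.update_of_ne (Finset.ne_of_mem_erase hj) _ _
      rw [heq] at hS
      rw [Finset.card_erase_of_mem hiS]
      omega
    obtain ⟨S₁, hi₁, hS₁⟩ := viol _ hlt1
    obtain ⟨S₂, hi₂, hS₂⟩ := viol _ hlt2
    have hmod := Submodule.finrank_sup_add_finrank_inf_eq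
      (Submodule.span K {x} ⊔ ⨆ j ∈ S₁, W j) ((C ⊓ W i) ⊔ ⨆ j ∈ S₂, W j)
    have hbig : (⨆ j ∈ insert i (S₁ ∪ S₂), W j) ≤
        (Submodule.span K {x} ⊔ ⨆ j ∈ S₁, W j) ⊔ ((C ⊓ W i) ⊔ ⨆ j ∈ S₂, W j) := by
      rw [sup_sup_sup_comm, hsup, Finset.iSup_insert, Finset.iSup_union]
    have hsmall : (⨆ j ∈ S₁ ∩ S₂, W j) ≤
        (Submodule.span K {x} ⊔ ⨆ j ∈ S₁, W j) ⊓ ((C ⊓ W i) ⊔ ⨆ j ∈ S₂, W j) :=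
      le_inf
        (le_sup_of_le_right (biSup_mono fun j hj => (Finset.mem_inter.1 hj).1))
        (le_sup_of_le_right (biSup_mono fun j hj => (Finset.mem_inter.1 hj).2))
    have h3 := (hW.prop _).trans (Submodule.finrank_mono hbig)
    have h4 := (hW.prop _).trans (Submodule.finrank_mono hsmall)
    have h5 := Finset.card_union_add_card_inter S₁ S₂
    rw [Finset.card_insert_of_notMem (by simp [hi₁, hi₂])] at h3
    omega
  choose v hv using key
  refine ⟨v, fun i => hWU i (by rw [hv]; exact Submodule.mem_span_singleton_self _), ?_⟩
  rw [linearIndependent_iff_card_le_finrank_span, Set.finrank]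
  have h1 := hW.prop Finset.univ
  have h2 : (⨆ i ∈ Finset.univ, W i) = Submodule.span K (Set.range v) := by
    simp [hv, Submodule.span_range_eq_iSup]
  rwa [h2] at h1

/-- If every set of a family admits an independent transversal of the subspaces `U p`, and every
position lies in fewer than `|K|` sets of the family, then there is a common choice of vectors
which is independent on every set of the family. -/
theorem exists_forall_linearIndepOn [Finite K] [FiniteDimensional K V] {P ι : Type*} [Finite P]
    [Finite ι] (U : P → Submodule K V) (S : ι → Set P)
    (hS : ∀ t, ∃ w : P → V, (∀ p, w p ∈ U p) ∧ LinearIndepOn K w (S t))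
    (hcard : ∀ p, {t | p ∈ S t}.ncard < Nat.card K) :
    ∃ v : P → V, (∀ p, v p ∈ U p) ∧ ∀ t, LinearIndepOn K v (S t) := by
  have : Fintype P := Fintype.ofFinite P
  have : Fintype ι := Fintype.ofFinite ι
  suffices h : ∀ A : Finset P, ∃ v : P → V, (∀ p, v p ∈ U p) ∧
      ∀ t, ∃ w : P → V, (∀ p, w p ∈ U p) ∧ (∀ p ∈ A, w p = v p) ∧ LinearIndepOn K w (S t) by
    obtain ⟨v, hv, h⟩ := h Finset.univ
    refine ⟨v, hv, fun t => ?_⟩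
    obtain ⟨w, -, hwv, hw⟩ := h t
    rwa [← funext fun p => hwv p (Finset.mem_univ p)]
  intro A
  induction A using Finset.induction_on with
  | empty =>
    refine ⟨0, fun p => (U p).zero_mem, fun t => ?_⟩
    obtain ⟨w, h1, h2⟩ := hS t
    exact ⟨w, h1, by simp, h2⟩
  | insert p A hpA ih =>
    obtain ⟨v, hv, h⟩ := ih
    choose w hwU hwv hw using h
    obtain ⟨x, hxU, hx⟩ := Submodule.exists_mem_forall_notMem_of_card_lt
      {t | p ∈ S t}.toFinset (U p)
      (fun t => Submodule.span K (w t '' (S t \ {p})))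
      (fun t ht hle => (hw t).notMem_span (by simpa using ht) (hle (hwU t p)))
      ((Set.ncard_eq_toFinset_card' _).symm.trans_lt (hcard p))
    have hmem : ∀ w : P → V, (∀ p, w p ∈ U p) → ∀ p', Function.update w p x p' ∈ U p' := by
      intro w hw p'
      rcases eq_or_ne p' p with rfl | hne
      · simpa using hxU
      · simpa [hne] using hw p'
    refine ⟨Function.update v p x, hmem v hv, fun t =>
      ⟨Function.update (w t) p x, hmem _ (hwU t), fun p' hp' => ?_, ?_⟩⟩
    · rcases eq_or_ne p' p with rfl | hne
      · simp
      · simpa [hne] using hwv t p' (Finset.mem_of_mem_insert_of_ne hp' hne)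
    · have heq : ∀ B : Set P, p ∉ B → Set.EqOn (Function.update (w t) p x) (w t) B :=
        fun B hB p' hp' => Function.update_of_ne (by rintro rfl; exact hB hp') _ _
      by_cases hpt : p ∈ S t
      · have hnot : p ∉ S t \ {p} := by simp
        have hins : S t = insert p (S t \ {p}) := by simp [Set.insert_eq_of_mem hpt]
        rw [hins, linearIndepOn_insert hnot, Function.update_self, (heq _ hnot).image_eq]
        refine ⟨((hw t).mono Set.sdiff_subset).congr (heq _ hnot).symm, hx t (by simpa using hpt)⟩
      · exact (hw t).congr (heq _ hpt).symm

/-- A finite family with `s.ncard` at most the dimension of the span of its image is independent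
on `s`. -/
theorem linearIndepOn_of_ncard_le_finrank_span {P : Type*} [Finite P] {v : P → V} {s : Set P}
    (h : s.ncard ≤ Module.finrank K ↥(Submodule.span K (v '' s))) : LinearIndepOn K v s := by
  have : Fintype s := Fintype.ofFinite s
  rw [LinearIndepOn, linearIndependent_iff_card_le_finrank_span, Set.finrank,
    ← Nat.card_eq_fintype_card, Nat.card_coe_set_eq]
  rwa [Set.range_comp', Subtype.range_coe]

theorem LinearIndepOn.finrank_span_image {P : Type*} [Finite P] {v : P → V} {s : Set P}
    (h : LinearIndepOn K v s) : Module.finrank K ↥(Submodule.span K (v '' s)) = s.ncard := by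
  have : Fintype s := Fintype.ofFinite s
  have := finrank_span_eq_card (R := K) h
  rwa [Set.range_comp', Subtype.range_coe, ← Nat.card_eq_fintype_card, Nat.card_coe_set_eq] at this

end LinearAlgebra

namespace DiscretePolymatroid

variable {r : ℕ} (D : DiscretePolymatroid r)

theorem setSum_le_rho {u : Fin r → ℕ} (hu : u ∈ D.carrier) (A : Set (Fin r)) :
    setSum u A ≤ D.rho A :=
  Finset.le_sup (f := fun u => setSum u A) (D.finite.mem_toFinset.2 hu)

theorem exists_setSum_eq_rho (A : Set (Fin r)) : ∃ u ∈ D.carrier, setSum u A = D.rho A := by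
  obtain ⟨u, hu, h⟩ := Finset.exists_mem_eq_sup D.finite.toFinset
    (D.finite.toFinset_nonempty.2 D.nonempty) (fun u => setSum u A)
  exact ⟨u, D.finite.mem_toFinset.1 hu, h.symm⟩

theorem setSum_univ (u : Fin r → ℕ) : setSum u Set.univ = ∑ i, u i := by
  simp [setSum]

theorem setSum_singleton (u : Fin r → ℕ) (i : Fin r) : setSum u {i} = u i := by
  simp [setSum, Finset.filter_eq']

theorem setSum_mono {u v : Fin r → ℕ} (h : u ≤ v) (A : Set (Fin r)) : setSum u A ≤ setSum v A :=
  Finset.sum_le_sum fun i _ => h i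

theorem apply_le_rho {u : Fin r → ℕ} (hu : u ∈ D.carrier) (i : Fin r) : u i ≤ D.rho {i} :=
  (setSum_singleton u i).symm.trans_le (D.setSum_le_rho hu {i})

variable {D} in
theorem IsBasisVec.sum_eq_rank {b : Fin r → ℕ} (hb : D.IsBasisVec b) : ∑ i, b i = D.rank := by
  obtain ⟨u, hu, h⟩ := D.exists_setSum_eq_rho Set.univ
  refine le_antisymm ((setSum_univ b).symm.trans_le (D.setSum_le_rho hb.1 _)) ?_
  by_contra! hlt
  rw [rank, ← h, setSum_univ] at hlt
  obtain ⟨w, hw, hbw, hne, -⟩ := D.exchange b hb.1 u hu hlt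
  exact hne (hb.2 w hw hbw).symm

theorem exists_isBasisVec_ge {u : Fin r → ℕ} (hu : u ∈ D.carrier) :
    ∃ b, D.IsBasisVec b ∧ u ≤ b := by
  obtain ⟨b, hub, hb⟩ := D.finite.exists_le_maximal hu
  exact ⟨b, ⟨hb.prop, fun v hv hbv => le_antisymm (hb.le_of_ge hv hbv) hbv⟩, hub⟩

theorem exists_isMinExcluded_le {u : Fin r → ℕ} (hu : D.IsExcluded u) :
    ∃ c, D.IsMinExcluded c ∧ c ≤ u := by
  obtain ⟨c, hcu, hc⟩ := exists_minimal_le_of_wellFoundedLT D.IsExcluded u hu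
  exact ⟨c, ⟨hc.prop, fun v hv hvc => le_antisymm hvc (hc.le_of_le hv hvc)⟩, hcu⟩

variable {D} in
theorem IsMinExcluded.mem_of_lt {c v : Fin r → ℕ} (hc : D.IsMinExcluded c) (hv : v < c) :
    v ∈ D.carrier := by
  by_contra h
  exact hv.ne (hc.2 v ⟨fun i => (hv.le i).trans (hc.1.1 i), h⟩ hv.le)

variable {D} in
/-- The support of a minimal excluded vector has rank smaller than the size of the vector. -/
theorem IsMinExcluded.rho_support_lt {c : Fin r → ℕ} (hc : D.IsMinExcluded c) :
    D.rho {i | c i ≠ 0} < ∑ i, c i := by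
  by_contra! hle
  have hmem : ∀ i, c i ≠ 0 → Function.update c i (c i - 1) ∈ D.carrier := fun i hi =>
    hc.mem_of_lt (update_lt_self_iff.2 (by omega))
  obtain ⟨j, hj⟩ : ∃ j, c j ≠ 0 := by
    by_contra! h
    obtain ⟨u, hu⟩ := D.nonempty
    exact hc.1.2 (D.lower u hu c fun i => by simp [h i])
  obtain ⟨u, hu, hu_eq⟩ := D.exists_setSum_eq_rho {i | c i ≠ 0}
  set v : Fin r → ℕ := fun i => if c i ≠ 0 then u i else 0 with hv_def
  have hv : v ∈ D.carrier := D.lower u hu v fun i => by simp only [hv_def]; split_ifs <;> simp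
  have hsum_v : ∑ i, v i = D.rho {i | c i ≠ 0} := by
    rw [← hu_eq, setSum, Finset.sum_filter]
    exact Finset.sum_congr rfl fun l _ => by by_cases h : c l = 0 <;> simp [hv_def, h]
  have hsum_update : ∀ i, c i ≠ 0 → ∑ l, Function.update c i (c i - 1) l < ∑ l, c l := by
    intro i hi
    refine Finset.sum_lt_sum (fun l _ => ?_) ⟨i, Finset.mem_univ i, by simp; omega⟩
    exact (update_le_self_iff.2 (by omega) : Function.update c i (c i - 1) ≤ c) l
  obtain ⟨w, hw, hcw, hne, hwv⟩ := D.exchange _ (hmem j hj) v hv (by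
    have := hsum_update j hj
    omega)
  obtain ⟨i, hi⟩ : ∃ i, Function.update c j (c j - 1) i < w i := by
    by_contra! h
    exact hne (le_antisymm hcw h)
  have hij : i ≠ j := by
    rintro rfl
    refine hc.1.2 (D.lower w hw c fun l => ?_)
    rcases eq_or_ne l i with rfl | hl
    · simp at hi
      omega
    · simpa [hl] using hcw l
  have hci : c i ≠ 0 := by
    intro h0
    have := hwv i
    simp [hv_def, h0, hij] at this hi
    omega
  rw [Function.update_of_ne hij] at hi
  have hw' : Function.update (Function.update c j (c j - 1)) i (c i + 1) ∈ D.carrier := by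
    refine D.lower w hw _ fun l => ?_
    rcases eq_or_ne l i with rfl | hl
    · simpa using hi
    · simpa [hl] using hcw l
  have hsum_w : ∑ l, Function.update (Function.update c j (c j - 1)) i (c i + 1) l = ∑ l, c l := by
    rw [Finset.sum_update_of_mem (Finset.mem_univ i), ← Finset.add_sum_erase _ c (Finset.mem_univ i),
      Finset.sdiff_singleton_eq_erase, Finset.sum_update_of_mem (by simp [hij.symm]),
      ← Finset.add_sum_erase _ c (show j ∈ Finset.univ.erase i by simp [hij.symm]),
      Finset.sdiff_singleton_eq_erase]
    omega
  obtain ⟨z, hz, hcz, hne', hzw⟩ := D.exchange _ (hmem i hci) _ hw' (by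
    rw [hsum_w]
    exact hsum_update i hci)
  refine hc.1.2 (D.lower z hz c fun l => ?_)
  have hzc : ∀ l, l ≠ i → z l = c l := by
    intro l hl
    have h1 := hcz l
    have h2 := hzw l
    rcases eq_or_ne l j with rfl | hlj
    · simp [hl] at h1 h2
      omega
    · simp [hl, hlj] at h1 h2
      omega
  rcases eq_or_ne l i with rfl | hl
  · by_contra! hlt
    refine hne' (funext fun m => ?_)
    rcases eq_or_ne m l with rfl | hm
    · have h1 := hcz m
      simp at h1 ⊢
      omega
    · simp [hm, hzc m hm]
  · exact (hzc l hl).ge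

variable {D}

theorem ncard_inter_fst_preimage (T : Set (Σ i : Fin r, Fin (D.rho {i}))) (A : Set (Fin r)) :
    (T ∩ Sigma.fst ⁻¹' A).ncard = setSum (D.sliceCard T) A := by
  have h : (T ∩ Sigma.fst ⁻¹' A).toFinset = (Finset.univ.filter (· ∈ A)).sigma
      fun l => {p : Fin (D.rho {l}) | (⟨l, p⟩ : Σ i : Fin r, Fin (D.rho {i})) ∈ T}.toFinset := by
    ext ⟨l, p⟩
    simp [and_comm]
  rw [Set.ncard_eq_toFinset_card', h, Finset.card_sigma]
  exact Finset.sum_congr rfl fun l _ => (Set.ncard_eq_toFinset_card' _).symm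

theorem ncard_eq_sum_sliceCard (T : Set (Σ i : Fin r, Fin (D.rho {i}))) :
    T.ncard = ∑ l, D.sliceCard T l := by
  simpa [setSum_univ] using ncard_inter_fst_preimage T Set.univ

theorem sliceCard_univ (l : Fin r) : D.sliceCard Set.univ l = D.rho {l} := by
  simp [sliceCard, Set.ncard_univ]

theorem sliceCard_inter_fst_preimage_le (T : Set (Σ i : Fin r, Fin (D.rho {i}))) (A : Set (Fin r))
    (l : Fin r) : D.sliceCard (T ∩ Sigma.fst ⁻¹' A) l ≤ D.sliceCard T l :=
  Set.ncard_le_ncard fun _ hp => hp.1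

theorem exists_subset_sliceCard_eq (T : Set (Σ i : Fin r, Fin (D.rho {i}))) {u : Fin r → ℕ}
    (hu : u ≤ D.sliceCard T) : ∃ T' ⊆ T, ∀ l, D.sliceCard T' l = u l := by
  choose s hs hcard using fun l => Set.exists_subset_card_eq (hu l)
  exact ⟨{e | e.2 ∈ s e.1}, fun e he => hs e.1 he, hcard⟩

theorem exists_superset_sliceCard_eq (T : Set (Σ i : Fin r, Fin (D.rho {i}))) {u : Fin r → ℕ}
    (hTu : D.sliceCard T ≤ u) (hu : ∀ l, u l ≤ D.rho {l}) :
    ∃ T', T ⊆ T' ∧ ∀ l, D.sliceCard T' l = u l := by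
  choose s hs _ hcard using fun l => Set.exists_subsuperset_card_eq
    (Set.subset_univ {p : Fin (D.rho {l}) | (⟨l, p⟩ : Σ i : Fin r, Fin (D.rho {i})) ∈ T})
    (hTu l) (by simpa [Set.ncard_univ] using hu l)
  exact ⟨{e | e.2 ∈ s e.1}, fun e he => hs e.1 he, hcard⟩

theorem sliceCard_diff_singleton {T : Set (Σ i : Fin r, Fin (D.rho {i}))}
    {e : Σ i : Fin r, Fin (D.rho {i})} (he : e ∈ T) (l : Fin r) :
    D.sliceCard (T \ {e}) l = if l = e.1 then D.sliceCard T l - 1 else D.sliceCard T l := by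
  obtain ⟨i, q⟩ := e
  split_ifs with hl
  · obtain rfl : l = i := hl
    rw [sliceCard, sliceCard, ← Set.ncard_sdiff_singleton_of_mem (a := q) he]
    congr 1
    ext p
    simp
  · rw [sliceCard, sliceCard]
    congr 1
    ext p
    simp only [Set.mem_sdiff, Set.mem_singleton_iff, Set.mem_ofPred_eq, and_iff_left_iff_imp]
    rintro - h
    exact hl (congrArg Sigma.fst h)

/-- Each element lies in fewer than `D.Nbound` sets whose shape is a basis vector. -/
theorem ncard_setOf_mem_lt_Nbound
    (e : Σ i : Fin r, Fin (D.rho {i})) :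
    {T : {T : Set (Σ i : Fin r, Fin (D.rho {i})) // D.IsBasisVec (D.sliceCard T)} |
      e ∈ T.1}.ncard < D.Nbound := by
  have : Fintype {T : Set (Σ i : Fin r, Fin (D.rho {i})) // D.IsBasisVec (D.sliceCard T)} :=
    Fintype.ofFinite _
  rw [Set.ncard_eq_toFinset_card', Nbound, add_comm, Nat.lt_succ_iff]
  refine le_trans ?_ (Finset.le_sup (Finset.mem_univ e.1))
  rw [Finset.card_eq_sum_card_fiberwise
    (t := D.finite.toFinset.filter fun b => D.IsBasisVec b ∧ 0 < b e.1)
    (f := fun T => D.sliceCard T.1)]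
  · refine Finset.sum_le_sum fun b _ => ?_
    have hprod : Nat.choose (D.rho {e.1}) (b e.1 - 1) *
        ∏ j ∈ (Finset.univ.filter fun j : Fin r => b j ≠ 0).erase e.1,
          Nat.choose (D.rho {j}) (b j) = (Fintype.piFinset fun j : Fin r => Finset.powersetCard
            (if j = e.1 then b j - 1 else b j)
            (Finset.univ : Finset (Fin (D.rho {j})))).card := by
      rw [Fintype.card_piFinset, ← Finset.mul_prod_erase _ _ (Finset.mem_univ e.1)]
      simp only [Finset.card_powersetCard, Finset.card_univ, Fintype.card_fin, if_true]
      congr 1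
      refine Finset.prod_subset_one_on_sdiff (Finset.erase_subset_erase _ (Finset.filter_subset _ _))
        (fun j hj => ?_) (fun j hj => ?_)
      · obtain ⟨hje, hbj⟩ : ¬ j = e.1 ∧ (¬ j = e.1 → b j = 0) := by simpa using hj
        simp [hje, hbj hje]
      · rw [if_neg (Finset.ne_of_mem_erase hj)]
    rw [hprod]
    refine Finset.card_le_card_of_injOn
      (fun T j => {p | (⟨j, p⟩ : Σ i : Fin r, Fin (D.rho {i})) ∈ T.1 \ {e}}.toFinset) ?_ ?_
    · intro T hT
      obtain ⟨heT, rfl⟩ : e ∈ T.1 ∧ D.sliceCard T.1 = b := by simpa using hT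
      refine Finset.mem_coe.2 (Fintype.mem_piFinset.2 fun j =>
        Finset.mem_powersetCard.2 ⟨Finset.subset_univ _, ?_⟩)
      rw [← sliceCard_diff_singleton heT, sliceCard, Set.ncard_eq_toFinset_card']
    · intro T hT T' hT' h
      have heT : e ∈ T.1 := by simp at hT; exact hT.1
      have heT' : e ∈ T'.1 := by simp at hT'; exact hT'.1
      have hdiff : T.1 \ {e} = T'.1 \ {e} := by
        ext ⟨j, p⟩
        have := congrArg (p ∈ ·) (congrFun h j)
        simpa only [Set.mem_toFinset, Set.mem_ofPred_eq, eq_iff_iff] using this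
      refine Subtype.ext ?_
      rw [← Set.insert_sdiff_self_of_mem heT, hdiff, Set.insert_sdiff_self_of_mem heT']
  · intro T hT
    have heT : e ∈ T.1 := by simpa using hT
    simp only [Finset.coe_filter, Set.mem_ofPred_eq, Set.Finite.mem_toFinset]
    exact ⟨T.2.1, T.2, (Set.ncard_pos).2 ⟨e.2, heT⟩⟩

end DiscretePolymatroid

/-- A linear encoding map is decodable at a receiver exactly when the demanded message vanishes
whenever the side information and the broadcast vanish. -/
theorem hasLinearIndexCode_iff {M : Type} (P : IndexProblem M) (F : Type) [Field F] (n c : ℕ) :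
    HasLinearIndexCode P F n c ↔ ∃ f : (M → Fin n → F) →ₗ[F] (Fin c → F),
      ∀ p ∈ P.recv, ∀ y, (∀ j ∈ p.2, y j = 0) → f y = 0 → y p.1 = 0 := by
  refine exists_congr fun f => forall₂_congr fun p _ => ⟨?_, fun h => ?_⟩
  · rintro ⟨ψ, hψ⟩ y hy hf
    have h0 : (fun j : ↥p.2 => y j.1) = 0 := funext fun j => hy j.1 j.2
    rw [← hψ y, h0, hf]
    exact map_zero ψ
  · obtain ⟨ψ, hψ⟩ := LinearMap.exists_comp_eq_of_ker_le_ker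
      ((LinearMap.funLeft F (Fin n → F) (Subtype.val : ↥p.2 → M)).prod f)
      (LinearMap.proj p.1 : (M → Fin n → F) →ₗ[F] (Fin n → F)) (by
        intro y hy
        obtain ⟨h1, h2⟩ := Prod.ext_iff.1 (LinearMap.mem_ker.1 hy)
        exact h y (fun j hj => congrFun h1 ⟨j, hj⟩) h2)
    exact ⟨ψ, fun y => LinearMap.congr_fun hψ y⟩

/-- A functional vanishing on the common kernel of `v q`, `q ∈ S`, is in the span of these. -/
theorem Module.Dual.mem_span_image_of_forall {F X P : Type*} [Field F] [AddCommGroup X] [Module F X]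
    [Finite P] {v : P → Module.Dual F X} {S : Set P} {L : Module.Dual F X}
    (h : ∀ x, (∀ q ∈ S, v q x = 0) → L x = 0) : L ∈ Submodule.span F (v '' S) := by
  have := mem_span_of_iInf_ker_le_ker (L := fun q : S => v q) (K := L) fun x hx => by
    rw [Submodule.mem_iInf] at hx
    exact h x fun q hq => hx ⟨q, hq⟩
  rwa [Set.range_comp', Subtype.range_coe] at this

namespace DiscretePolymatroid

variable {r : ℕ} {D : DiscretePolymatroid r}

/-- A system of `n` vectors for each element which is independent on the sets whose shape is a
basis vector, and satisfies the dependencies prescribed by the minimal excluded vectors, spans a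
representation of `nD`. -/
theorem repFnOver_of_vectors {F : Type} [Field F] {M : Type*} [AddCommGroup M] [Module F M]
    [FiniteDimensional F M] {n : ℕ} (v : (Σ i : Fin r, Fin (D.rho {i})) × Fin n → M)
    (hind : ∀ T, D.IsBasisVec (D.sliceCard T) → LinearIndepOn F v (T ×ˢ Set.univ))
    (hdep : ∀ c, D.IsMinExcluded c → ∀ j, c j ≠ 0 → ∀ (p : Fin (D.rho {j}))
      (T : Set (Σ i : Fin r, Fin (D.rho {i}))), (∀ l, l ≠ j → D.sliceCard T l = c l) →
      D.sliceCard T j = c j - 1 → ⟨j, p⟩ ∉ T →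
      ∀ s, v (⟨j, p⟩, s) ∈ Submodule.span F (v '' (T ×ˢ Set.univ))) :
    RepFnOver r (fun X => n * D.rho X) F := by
  refine ⟨Module.finrank F M, fun i => (Submodule.span F (v '' {q | q.1.1 = i})).map
    (Module.finBasis F M).equivFun.toLinearMap, fun X => ?_⟩
  have hsup : (⨆ i ∈ X, (Submodule.span F (v '' {q | q.1.1 = i}))) =
      Submodule.span F (v '' {q | q.1.1 ∈ X}) := by
    rw [← Submodule.span_iUnion₂, ← Set.image_iUnion₂]
    congr 2
    ext q
    simp
  have hmap : (⨆ i ∈ X, (Submodule.span F (v '' {q | q.1.1 = i})).map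
      (Module.finBasis F M).equivFun.toLinearMap) = (Submodule.span F (v '' {q | q.1.1 ∈ X})).map
      (Module.finBasis F M).equivFun.toLinearMap := by
    simp only [← hsup, Submodule.map_iSup]
  rw [hmap, LinearEquiv.finrank_map_eq]
  obtain ⟨u, hu, huX⟩ := D.exists_setSum_eq_rho X
  obtain ⟨b, hb, hub⟩ := D.exists_isBasisVec_ge hu
  have hbX : setSum b X = D.rho X :=
    le_antisymm (D.setSum_le_rho hb.1 X) (huX.symm.trans_le (setSum_mono hub X))
  obtain ⟨T, -, hT⟩ := exists_subset_sliceCard_eq (D := D) Set.univ (u := b)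
    (fun l => (D.apply_le_rho hb.1 l).trans_eq (sliceCard_univ l).symm)
  obtain rfl : D.sliceCard T = b := funext hT
  set TX := T ∩ Sigma.fst ⁻¹' X with hTX
  have hspan : Submodule.span F (v '' {q | q.1.1 ∈ X}) =
      Submodule.span F (v '' (TX ×ˢ Set.univ)) := by
    refine le_antisymm (Submodule.span_le.2 ?_)
      (Submodule.span_mono (Set.image_mono fun q hq => hq.1.2))
    rintro _ ⟨⟨⟨j, p⟩, s⟩, hj, rfl⟩
    have hjX : j ∈ X := hj
    by_cases hjT : (⟨j, p⟩ : Σ i : Fin r, Fin (D.rho {i})) ∈ T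
    · exact Submodule.subset_span ⟨_, ⟨⟨hjT, hj⟩, Set.mem_univ _⟩, rfl⟩
    have hj_TX : (⟨j, p⟩ : Σ i : Fin r, Fin (D.rho {i})) ∉ TX := fun h => hjT h.1
    set T' := insert (⟨j, p⟩ : Σ i : Fin r, Fin (D.rho {i})) TX with hT'
    have hshape : ∀ l, D.sliceCard TX l =
        if l = j then D.sliceCard T' l - 1 else D.sliceCard T' l := by
      intro l
      rw [← sliceCard_diff_singleton (e := ⟨j, p⟩) (Set.mem_insert _ _) l,
        Set.insert_sdiff_self_of_notMem hj_TX]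
    have hTX_mem : D.sliceCard TX ∈ D.carrier :=
      D.lower _ hb.1 _ (sliceCard_inter_fst_preimage_le T X)
    have hexc : D.IsExcluded (D.sliceCard T') := by
      refine ⟨fun l => (Set.ncard_le_ncard (Set.subset_univ _)).trans_eq (sliceCard_univ l), ?_⟩
      intro hmem
      have h1 := D.setSum_le_rho hmem X
      rw [← ncard_inter_fst_preimage, ← hbX, ← ncard_inter_fst_preimage] at h1
      have h2 : T' ∩ Sigma.fst ⁻¹' X = T' := Set.inter_eq_left.2 <|
        Set.insert_subset hjX fun e he => he.2
      rw [h2, hT', Set.ncard_insert_of_notMem hj_TX, hTX] at h1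
      omega
    obtain ⟨c, hc, hcT⟩ := D.exists_isMinExcluded_le hexc
    have hcj : D.sliceCard TX j < c j := by
      by_contra! hle
      refine hc.1.2 (D.lower _ hTX_mem c fun l => ?_)
      by_cases hl : l = j
      · rwa [hl]
      · rw [hshape l, if_neg hl]
        exact hcT l
    obtain ⟨T₀, hT₀, hcard⟩ := exists_subset_sliceCard_eq TX (u := fun l => if l = j then c l - 1 else c l)
      (fun l => by
        have := hcT l
        rw [hshape l]
        by_cases hl : l = j
        · simp only [hl, if_true] at this ⊢
          omega
        · simpa [hl] using this)
    refine Submodule.span_mono (Set.image_mono (Set.prod_mono_left hT₀))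
      (hdep c hc j (by omega) p T₀ (fun l hl => ?_) ?_ (fun h => hj_TX (hT₀ h)) s)
    · rw [hcard, if_neg hl]
    · rw [hcard, if_pos rfl]
  rw [hspan, ((hind T hb).mono (Set.prod_mono_left Set.inter_subset_left)).finrank_span_image,
    Set.ncard_prod, ncard_inter_fst_preimage, hbX, Set.ncard_univ, Nat.card_fin, mul_comm]

theorem repFnOver_of_hasLinearIndexCode {F : Type} [Field F] {n : ℕ}
    (h : HasLinearIndexCode D.indexProblem F n (n * D.indexCodeLen)) :
    RepFnOver r (fun X => n * D.rho X) F := by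
  obtain ⟨f, hf⟩ := (hasLinearIndexCode_iff _ _ _ _).1 h
  let inX : (Fin D.rank → Fin n → F) →ₗ[F] (D.Msg → Fin n → F) :=
    { toFun := fun x => Sum.elim x 0
      map_add' := fun x y => by ext (j | e) <;> simp
      map_smul' := fun a x => by ext (j | e) <;> simp }
  let inY : ((Σ i : Fin r, Fin (D.rho {i})) → Fin n → F) →ₗ[F] (D.Msg → Fin n → F) :=
    { toFun := fun y => Sum.elim 0 y
      map_add' := fun x y => by ext (j | e) <;> simp
      map_smul' := fun a x => by ext (j | e) <;> simp }
  have hinj : Function.Injective (f ∘ₗ inY) := by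
    rw [injective_iff_map_eq_zero]
    intro y hy
    funext e
    exact hf (Sum.inr e, Set.range Sum.inl) (Or.inr ⟨e.1, e.2, rfl⟩) (inY y)
      (by rintro _ ⟨j, rfl⟩; rfl) hy
  let g := LinearEquiv.ofInjectiveOfFinrankEq (f ∘ₗ inY) hinj (by
    rw [Module.finrank_fin_fun]
    simp [Module.finrank_pi_fintype, indexCodeLen, Finset.mul_sum, mul_comm])
  let G : (Fin D.rank → Fin n → F) →ₗ[F] ((Σ i : Fin r, Fin (D.rho {i})) → Fin n → F) :=
    -(g.symm.toLinearMap ∘ₗ f ∘ₗ inX)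
  have hG : ∀ x, f (inX x + inY (G x)) = 0 := by
    intro x
    have : f (inY (G x)) = g (G x) := rfl
    rw [map_add, this]
    simp [G]
  let v : (Σ i : Fin r, Fin (D.rho {i})) × Fin n → Module.Dual F (Fin D.rank → Fin n → F) :=
    fun q => LinearMap.proj q.2 ∘ₗ LinearMap.proj q.1 ∘ₗ G
  have hzero : ∀ (T : Set (Σ i : Fin r, Fin (D.rho {i}))) x,
      (∀ q ∈ T ×ˢ (Set.univ : Set (Fin n)), v q x = 0) →
      ∀ m ∈ (Sum.inr '' T : Set D.Msg), (inX x + inY (G x)) m = 0 := by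
    rintro T x hx _ ⟨e, he, rfl⟩
    ext s
    simpa [inX, inY, v] using hx (e, s) ⟨he, Set.mem_univ s⟩
  refine repFnOver_of_vectors v (fun T hT => ?_) (fun c hc j hj p T h1 h2 h3 s => ?_)
  · have htop : Submodule.span F (v '' (T ×ˢ Set.univ)) = ⊤ := by
      refine eq_top_iff.2 fun L _ => Module.Dual.mem_span_image_of_forall fun x hx => ?_
      have hx0 : x = 0 := by
        funext j
        simpa [inX, inY] using hf (Sum.inl j, Sum.inr '' T)
          (Or.inl (Or.inl ⟨_, hT, j, T, fun _ => rfl, rfl⟩)) _ (hzero T x hx) (hG x)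
      rw [hx0, map_zero]
    refine linearIndepOn_of_ncard_le_finrank_span ?_
    rw [htop, finrank_top, Subspace.dual_finrank_eq, Set.ncard_prod, ncard_eq_sum_sliceCard,
      hT.sum_eq_rank]
    simp [Module.finrank_pi_fintype, Set.ncard_univ]
  · refine Module.Dual.mem_span_image_of_forall fun x hx => ?_
    have := hf (Sum.inr ⟨j, p⟩, Sum.inr '' T)
      (Or.inl (Or.inr ⟨c, hc, j, hj, p, T, h1, h2, h3, rfl⟩)) _ (hzero T x hx) (hG x)
    simpa [inX, inY, v] using congrFun this s

theorem exists_vectors_of_repFn {F K : Type*} [Field F] [Finite F] [AddCommGroup K] [Module F K]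
    [FiniteDimensional F K] {n : ℕ} (hcard : D.Nbound < Nat.card F) (V : Fin r → Submodule F K)
    (hV : ∀ X : Set (Fin r), Module.finrank F ↥(⨆ i ∈ X, V i) = n * D.rho X) :
    ∃ v : (Σ i : Fin r, Fin (D.rho {i})) × Fin n → K, (∀ q, v q ∈ V q.1.1) ∧
      ∀ T, D.IsBasisVec (D.sliceCard T) → LinearIndepOn F v (T ×ˢ Set.univ) := by
  let S : {T : Set (Σ i : Fin r, Fin (D.rho {i})) // D.IsBasisVec (D.sliceCard T)} →
    Set ((Σ i : Fin r, Fin (D.rho {i})) × Fin n) := fun T => T.1 ×ˢ Set.univ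
  have htrans : ∀ T, ∃ w : (Σ i : Fin r, Fin (D.rho {i})) × Fin n → K,
      (∀ q, w q ∈ V q.1.1) ∧ LinearIndepOn F w (S T) := by
    rintro ⟨T, hT⟩
    obtain ⟨w, hwV, hw⟩ := exists_linearIndependent_mem_of_card_le_finrank
      (fun q : ↥(T ×ˢ (Set.univ : Set (Fin n))) => V q.1.1.1) (by
        intro S
        set X : Set (Fin r) := (fun q : ↥(T ×ˢ (Set.univ : Set (Fin n))) => q.1.1.1) '' S with hX
        have hsup : (⨆ q ∈ S, V q.1.1.1) = ⨆ i ∈ X, V i := by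
          rw [hX, iSup_image]
          rfl
        rw [hsup, hV]
        calc S.card = (Subtype.val '' (S : Set ↥(T ×ˢ (Set.univ : Set (Fin n))))).ncard := by
              rw [Set.ncard_image_of_injective _ Subtype.val_injective, Set.ncard_coe_finset]
          _ ≤ ((T ∩ Sigma.fst ⁻¹' X) ×ˢ (Set.univ : Set (Fin n))).ncard := by
              refine Set.ncard_le_ncard ?_
              rintro _ ⟨q, hq, rfl⟩
              exact ⟨⟨q.2.1, ⟨q, hq, rfl⟩⟩, Set.mem_univ _⟩
          _ = n * setSum (D.sliceCard T) X := by
              rw [Set.ncard_prod, ncard_inter_fst_preimage, Set.ncard_univ, Nat.card_fin, mul_comm]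
          _ ≤ n * D.rho X := Nat.mul_le_mul_left _ (D.setSum_le_rho hT.1 X))
    refine ⟨fun q => if h : q ∈ T ×ˢ (Set.univ : Set (Fin n)) then w ⟨q, h⟩ else 0, fun q => ?_, ?_⟩
    · dsimp only
      split_ifs with h
      · exact hwV ⟨q, h⟩
      · exact Submodule.zero_mem _
    · rw [LinearIndepOn]
      convert hw with q
      exact dif_pos q.2
  have hlt : ∀ q, {T | q ∈ S T}.ncard < Nat.card F := fun q => by
    refine lt_trans ?_ hcard
    simpa [S] using ncard_setOf_mem_lt_Nbound q.1
  obtain ⟨v, hvV, hv⟩ := exists_forall_linearIndepOn (fun q => V q.1.1) S htrans hlt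
  exact ⟨v, hvV, fun T hT => hv ⟨T, hT⟩⟩

theorem hasLinearIndexCode_of_repFnOver {F : Type} [Field F] [Finite F] {n : ℕ}
    (hcard : D.Nbound < Nat.card F) (h : RepFnOver r (fun X => n * D.rho X) F) :
    HasLinearIndexCode D.indexProblem F n (n * D.indexCodeLen) := by
  obtain ⟨d, V, hV⟩ := h
  obtain ⟨v, hvV, hv⟩ := exists_vectors_of_repFn hcard V hV
  set W : Submodule F (Fin d → F) := ⨆ i ∈ Set.univ, V i
  have hVW : ∀ q, v q ∈ W := fun q =>
    (le_iSup₂_of_le q.1.1 (Set.mem_univ _) le_rfl : V q.1.1 ≤ W) (hvV q)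
  have hWrank : Module.finrank F W = n * D.rank := hV Set.univ
  let φ : (Fin D.rank → Fin n → F) ≃ₗ[F] Module.Dual F W := LinearEquiv.ofFinrankEq _ _ (by
    rw [Subspace.dual_finrank_eq, hWrank]
    simp [Module.finrank_pi_fintype, mul_comm])
  let f₀ : (D.Msg → Fin n → F) →ₗ[F] ((Σ i : Fin r, Fin (D.rho {i})) × Fin n → F) :=
    { toFun := fun y q => y (Sum.inr q.1) q.2 + φ (fun j => y (Sum.inl j)) ⟨v q, hVW q⟩
      map_add' := fun x y => funext fun q => by
        change x (Sum.inr q.1) q.2 + y (Sum.inr q.1) q.2 +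
            φ ((fun j => x (Sum.inl j)) + fun j => y (Sum.inl j)) ⟨v q, hVW q⟩ =
          x (Sum.inr q.1) q.2 + φ (fun j => x (Sum.inl j)) ⟨v q, hVW q⟩ +
            (y (Sum.inr q.1) q.2 + φ (fun j => y (Sum.inl j)) ⟨v q, hVW q⟩)
        rw [map_add, LinearMap.add_apply]
        ring
      map_smul' := fun a x => funext fun q => by
        change a * x (Sum.inr q.1) q.2 + φ (a • fun j => x (Sum.inl j)) ⟨v q, hVW q⟩ =
          a * (x (Sum.inr q.1) q.2 + φ (fun j => x (Sum.inl j)) ⟨v q, hVW q⟩)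
        rw [map_smul, LinearMap.smul_apply, smul_eq_mul]
        ring }
  have hlen : Fintype.card ((Σ i : Fin r, Fin (D.rho {i})) × Fin n) = n * D.indexCodeLen := by
    simp [indexCodeLen, mul_comm]
  refine (hasLinearIndexCode_iff _ _ _ _).2
    ⟨(LinearEquiv.funCongrLeft F F (Fintype.equivFinOfCardEq hlen).symm).toLinearMap ∘ₗ f₀, ?_⟩
  have hker : ∀ y, ((LinearEquiv.funCongrLeft F F (Fintype.equivFinOfCardEq hlen).symm).toLinearMap
      ∘ₗ f₀) y = 0 → ∀ q : (Σ i : Fin r, Fin (D.rho {i})) × Fin n,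
      y (Sum.inr q.1) q.2 + φ (fun j => y (Sum.inl j)) ⟨v q, hVW q⟩ = 0 := by
    intro y hy
    exact congrFun ((LinearEquiv.map_eq_zero_iff
      (LinearEquiv.funCongrLeft F F (Fintype.equivFinOfCardEq hlen).symm)).1 hy)
  have hspan : ∀ (T : Set (Σ i : Fin r, Fin (D.rho {i}))) (y : D.Msg → Fin n → F),
      (∀ m ∈ (Sum.inr '' T : Set D.Msg), y m = 0) →
      (∀ q : (Σ i : Fin r, Fin (D.rho {i})) × Fin n,
        y (Sum.inr q.1) q.2 + φ (fun j => y (Sum.inl j)) ⟨v q, hVW q⟩ = 0) →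
      ∀ x : W, (x : Fin d → F) ∈ Submodule.span F (v '' (T ×ˢ Set.univ)) →
        φ (fun j => y (Sum.inl j)) x = 0 := by
    intro T y hyT hy x hx
    have hle : Submodule.span F (v '' (T ×ˢ Set.univ)) ≤
        (LinearMap.ker (φ fun j => y (Sum.inl j))).map W.subtype := by
      rw [Submodule.span_le]
      rintro _ ⟨q, hq, rfl⟩
      refine ⟨⟨v q, hVW q⟩, ?_, rfl⟩
      have := hy q
      rw [hyT (Sum.inr q.1) ⟨q.1, hq.1, rfl⟩] at this
      simpa using this
    obtain ⟨x', hx', hxx⟩ := hle hx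
    obtain rfl : x' = x := Subtype.ext hxx
    exact hx'
  rintro p ((⟨b, hb, j, T, hT, rfl⟩ | ⟨c, hc, j, hj, p, T, h1, h2, h3, rfl⟩) | ⟨i, p, rfl⟩) y hyH hy
  · obtain rfl : D.sliceCard T = b := funext hT
    have hTW : Submodule.span F (v '' (T ×ˢ Set.univ)) = W := by
      refine Submodule.eq_of_le_of_finrank_eq (Submodule.span_le.2 ?_) ?_
      · rintro _ ⟨q, -, rfl⟩
        exact hVW q
      · rw [(hv T hb).finrank_span_image, hWrank, Set.ncard_prod, ncard_eq_sum_sliceCard,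
          hb.sum_eq_rank, Set.ncard_univ, Nat.card_fin, mul_comm]
    have hφ : φ (fun j => y (Sum.inl j)) = 0 :=
      LinearMap.ext fun x => hspan T y hyH (hker y hy) x (by rw [hTW]; exact x.2)
    exact congrFun (φ.map_eq_zero_iff.1 hφ) j
  · set X : Set (Fin r) := {i | c i ≠ 0}
    have hTc : ∀ l, D.sliceCard T l = Function.update c j (c j - 1) l := by
      intro l
      rcases eq_or_ne l j with rfl | hl
      · simpa using h2
      · simpa [hl] using h1 l hl
    have hTmem : D.sliceCard T ∈ D.carrier := by
      rw [funext hTc]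
      exact hc.mem_of_lt (update_lt_self_iff.2 (by omega))
    have hind : LinearIndepOn F v (T ×ˢ Set.univ) := by
      obtain ⟨b, hb, hTb⟩ := D.exists_isBasisVec_ge hTmem
      obtain ⟨T', hTT', hT'⟩ := exists_superset_sliceCard_eq T hTb fun l => D.apply_le_rho hb.1 l
      exact (hv T' ((funext hT' : D.sliceCard T' = b) ▸ hb)).mono (Set.prod_mono_left hTT')
    have hTV : Submodule.span F (v '' (T ×ˢ Set.univ)) = ⨆ i ∈ X, V i := by
      refine Submodule.eq_of_le_of_finrank_le (Submodule.span_le.2 ?_) ?_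
      · rintro _ ⟨q, hq, rfl⟩
        have hqX : q.1.1 ∈ X := by
          intro h0
          have hpos : 0 < D.sliceCard T q.1.1 := (Set.ncard_pos (Set.toFinite _)).2 ⟨q.1.2, hq.1⟩
          rw [hTc] at hpos
          rcases eq_or_ne q.1.1 j with hl | hl
          · exact hj (hl ▸ h0)
          · rw [Function.update_of_ne hl] at hpos
            omega
        exact (le_iSup₂_of_le q.1.1 hqX le_rfl : V q.1.1 ≤ ⨆ i ∈ X, V i) (hvV q)
      · rw [hV, hind.finrank_span_image, Set.ncard_prod, ncard_eq_sum_sliceCard, Set.ncard_univ,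
          Nat.card_fin, mul_comm]
        refine Nat.mul_le_mul_left n ?_
        have hsum : ∑ l, c l = ∑ l, D.sliceCard T l + 1 := by
          rw [Finset.sum_congr rfl fun l _ => hTc l, Finset.sum_update_of_mem (Finset.mem_univ j),
            Finset.sdiff_singleton_eq_erase, ← Finset.add_sum_erase _ c (Finset.mem_univ j)]
          omega
        have : D.rho X < _ := hc.rho_support_lt
        omega
    funext s
    have h0 := hspan T y hyH (hker y hy) ⟨v (⟨j, p⟩, s), hVW _⟩ (by
      rw [hTV]
      exact (le_iSup₂_of_le j hj le_rfl : V j ≤ ⨆ i ∈ X, V i) (hvV (⟨j, p⟩, s)))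
    simpa [h0] using hker y hy (⟨j, p⟩, s)
  · have hx : (fun j => y (Sum.inl j)) = 0 := funext fun j => hyH _ ⟨j, rfl⟩
    funext s
    simpa [hx] using hker y hy (⟨i, p⟩, s)

end DiscretePolymatroid

/-- **Theorem 9.** For a finite field `F_q` with `q > N(D)`, a perfect linear index coding
solution of dimension `n` over `F_q` exists for the index coding problem `I^D(Z,R)` if and
only if the discrete polymatroid `nD` (with rank function `X ↦ n·ρ(X)`) is representable
over `F_q`. -/
theorem perfectLinearIndexCode_iff_representable
    {r : ℕ} (hr : 0 < r) (D : DiscretePolymatroid r) (n : ℕ) (hn : 0 < n)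
    (F : Type) [Field F] [Fintype F]
    (hcard : D.Nbound < Fintype.card F) :
    HasLinearIndexCode D.indexProblem F n (n * D.indexCodeLen) ↔
      RepFnOver r (fun X => n * D.rho X) F := by
  exact ⟨DiscretePolymatroid.repFnOver_of_hasLinearIndexCode,
    DiscretePolymatroid.hasLinearIndexCode_of_repFnOver (by rwa [Nat.card_eq_fintype_card])⟩
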